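/- Let R be a Cohen–Macaulay local ring of dimension d ≥ 2 with canonical module ω, and let 1 ≤ n ≤ d−1. Let M be a maximal Cohen–Macaulay R-module such that M_p has finite projective dimension over R_p for every prime p of height at most n. If Ext^i_R(Hom_R(M,R), Hom_R(M,ω)) = 0 for all n ≤ i ≤ d−1, then M is free. -/

import Mathlib

open CategoryTheory TensorProduct IsLocalRing

noncomputable section

/-- The `n`-th Ext group of two `R`-modules. -/
abbrev extGroup (R : Type) [CommRing R] (n : ℕ) (M N : Type) [AddCommGroup M] [Module R M]
    [AddCommGroup N] [Module R N] : Type :=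
  ((Ext R (ModuleCat R) n).obj (Opposite.op (ModuleCat.of R M))).obj (ModuleCat.of R N)

/-- The `n`-th Tor group of two `R`-modules. -/
abbrev torGroup (R : Type) [CommRing R] (n : ℕ) (M N : Type) [AddCommGroup M] [Module R M]
    [AddCommGroup N] [Module R N] : Type :=
  ((Tor (ModuleCat R) n).obj (ModuleCat.of R M)).obj (ModuleCat.of R N)

/-- The depth of a module over a local ring, as the infimum of the degrees in which
`Ext(k, N)` is nonzero. -/
def moduleDepth (R : Type) [CommRing R] [IsLocalRing R] (N : Type) [AddCommGroup N]
    [Module R N] : ℕ∞ :=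
  sInf {n : ℕ∞ | ∃ k : ℕ, n = k ∧
    Nontrivial (extGroup R k (R ⧸ IsLocalRing.maximalIdeal R) N)}

/-- A module is maximal Cohen–Macaulay if `depth M_p = dim R_p` for all `p` in the support. -/
def IsMCM (R : Type) [CommRing R] (M : Type) [AddCommGroup M] [Module R M] : Prop :=
  ∀ p : PrimeSpectrum R, Nontrivial (LocalizedModule p.asIdeal.primeCompl M) →
    (moduleDepth (Localization.AtPrime p.asIdeal)
        (LocalizedModule p.asIdeal.primeCompl M) : WithBot ℕ∞) =
      ringKrullDim (Localization.AtPrime p.asIdeal)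

/-- A local ring is Cohen–Macaulay if its depth equals its Krull dimension. -/
def IsCMLocal (R : Type) [CommRing R] [IsLocalRing R] : Prop :=
  (moduleDepth R R : WithBot ℕ∞) = ringKrullDim R

/-- Injective dimension at most `n`, defined recursively via cosyzygies. -/
def hasInjDimLE (R : Type) [CommRing R] : ℕ → ∀ (M : Type) [AddCommGroup M] [Module R M], Prop
  | 0, M, _, _ => Module.Injective R M
  | (n+1), M, _, _ => ∃ (I : Type) (_ : AddCommGroup I) (_ : Module R I) (f : M →ₗ[R] I),
      Module.Injective R I ∧ Function.Injective f ∧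
        hasInjDimLE R n (I ⧸ LinearMap.range f)

/-- Projective dimension at most `n`, defined recursively via syzygies. -/
def hasPdLE (R : Type) [CommRing R] : ℕ → ∀ (M : Type) [AddCommGroup M] [Module R M], Prop
  | 0, M, _, _ => Module.Projective R M
  | (n+1), M, _, _ => ∃ (P : Type) (_ : AddCommGroup P) (_ : Module R P) (f : P →ₗ[R] M),
      Module.Projective R P ∧ Function.Surjective f ∧ hasPdLE R n (LinearMap.ker f)

/-- `ω` is a canonical module of the Cohen–Macaulay local ring `R`: it is finitely generated,
maximal Cohen–Macaulay, of finite injective dimension, and of type one. -/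
def IsCanonicalModule (R : Type) [CommRing R] [IsLocalRing R] (ω : Type) [AddCommGroup ω]
    [Module R ω] : Prop :=
  Module.Finite R ω ∧ IsMCM R ω ∧ (∃ n, hasInjDimLE R n ω) ∧
    ∃ d : ℕ, ringKrullDim R = d ∧
      Nonempty (extGroup R d (R ⧸ IsLocalRing.maximalIdeal R) ω ≃ₗ[R]
        (R ⧸ IsLocalRing.maximalIdeal R))

/-- `T` is an Auslander transpose of `M`: the cokernel of the `R`-dual of a minimal
free presentation of `M`. -/
def IsAuslanderTranspose (R : Type) [CommRing R] [IsLocalRing R] (M T : Type)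
    [AddCommGroup M] [Module R M] [AddCommGroup T] [Module R T] : Prop :=
  ∃ (m n : ℕ) (f : (Fin n → R) →ₗ[R] (Fin m → R)),
    LinearMap.range f ≤ (IsLocalRing.maximalIdeal R) • (⊤ : Submodule R (Fin m → R)) ∧
    LinearMap.ker f ≤ (IsLocalRing.maximalIdeal R) • (⊤ : Submodule R (Fin n → R)) ∧
    Nonempty (((Fin m → R) ⧸ LinearMap.range f) ≃ₗ[R] M) ∧
    Nonempty ((Module.Dual R (Fin n → R) ⧸ LinearMap.range f.dualMap) ≃ₗ[R] T)

end

/-- The group `Ext^i(A, B)` is zero. -/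
def ExtVanishes (R : Type) [CommRing R] (A B : Type) [AddCommGroup A] [Module R A]
    [AddCommGroup B] [Module R B] (i : ℕ) : Prop :=
  Subsingleton (Abelian.Ext.{0} (ModuleCat.of R A) (ModuleCat.of R B) i)

namespace ExtVanishes

section LongExactSequence

variable {R : Type} [CommRing R] {A B C D : Type} [AddCommGroup A] [Module R A]
  [AddCommGroup B] [Module R B] [AddCommGroup C] [Module R C] [AddCommGroup D] [Module R D]

theorem of_linearEquiv_left {i : ℕ} (e : A ≃ₗ[R] B) (h : ExtVanishes R A D i) :
    ExtVanishes R B D i := by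
  have : Subsingleton (Abelian.Ext.{0} (ModuleCat.of R A) (ModuleCat.of R D) i) := h
  refine ⟨fun x y => ?_⟩
  have key (z : Abelian.Ext.{0} (ModuleCat.of R B) (ModuleCat.of R D) i) : z = 0 := by
    have h1 : (Abelian.Ext.mk₀ e.toModuleIso.inv).comp
        ((Abelian.Ext.mk₀ e.toModuleIso.hom).comp z (zero_add i)) (zero_add i) = z := by
      rw [Abelian.Ext.mk₀_comp_mk₀_assoc, Iso.inv_hom_id, Abelian.Ext.mk₀_id_comp]
    rw [← h1, Subsingleton.elim ((Abelian.Ext.mk₀ e.toModuleIso.hom).comp z (zero_add i)) 0]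
    simp
  rw [key x, key y]

theorem zero_iff : ExtVanishes R A D 0 ↔ Subsingleton (A →ₗ[R] D) :=
  (Abelian.Ext.addEquiv₀.trans ModuleCat.homAddEquiv).toEquiv.subsingleton_congr

theorem of_projective [Module.Projective R A] (i : ℕ) : ExtVanishes R A D (i + 1) := by
  have : Projective (ModuleCat.of R A) := (IsProjective.iff_projective A).1 ‹_›
  exact ⟨fun x y => by rw [x.eq_zero_of_projective, y.eq_zero_of_projective]⟩

variable {f : A →ₗ[R] B} {g : B →ₗ[R] C}

theorem shortExact (hf : Function.Injective f) (hfg : Function.Exact f g)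
    (hg : Function.Surjective g) :
    (ShortComplex.moduleCatMk f g hfg.linearMap_comp_eq_zero).ShortExact :=
  ModuleCat.shortComplex_shortExact _ hfg hf hg

theorem middle (hf : Function.Injective f) (hfg : Function.Exact f g)
    (hg : Function.Surjective g) {i : ℕ} (hA : ExtVanishes R A D i) (hC : ExtVanishes R C D i) :
    ExtVanishes R B D i := by
  have hS := shortExact hf hfg hg
  have key (z : Abelian.Ext.{0} (ModuleCat.of R B) (ModuleCat.of R D) i) : z = 0 := by
    obtain ⟨y, hy⟩ := Abelian.Ext.contravariant_sequence_exact₂ hS (ModuleCat.of R D) z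
      (hA.elim _ _)
    obtain rfl : y = 0 := hC.elim _ _
    exact hy.symm.trans (Abelian.Ext.comp_zero ..)
  exact ⟨fun x y => by rw [key x, key y]⟩

theorem left (hf : Function.Injective f) (hfg : Function.Exact f g)
    (hg : Function.Surjective g) {i : ℕ} (hB : ExtVanishes R B D i)
    (hC : ExtVanishes R C D (i + 1)) : ExtVanishes R A D i := by
  have hS := shortExact hf hfg hg
  have key (z : Abelian.Ext.{0} (ModuleCat.of R A) (ModuleCat.of R D) i) : z = 0 := by
    obtain ⟨y, hy⟩ := Abelian.Ext.contravariant_sequence_exact₁ hS (ModuleCat.of R D) z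
      (add_comm 1 i) (hC.elim _ _)
    obtain rfl : y = 0 := hB.elim _ _
    exact hy.symm.trans (Abelian.Ext.comp_zero ..)
  exact ⟨fun x y => by rw [key x, key y]⟩

theorem right (hf : Function.Injective f) (hfg : Function.Exact f g)
    (hg : Function.Surjective g) {i : ℕ} (hA : ExtVanishes R A D i)
    (hB : ExtVanishes R B D (i + 1)) : ExtVanishes R C D (i + 1) := by
  have hS := shortExact hf hfg hg
  have key (z : Abelian.Ext.{0} (ModuleCat.of R C) (ModuleCat.of R D) (i + 1)) : z = 0 := by
    obtain ⟨y, hy⟩ := Abelian.Ext.contravariant_sequence_exact₃ hS (ModuleCat.of R D) z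
      (hB.elim _ _) (add_comm 1 i)
    obtain rfl : y = 0 := hA.elim _ _
    exact hy.symm.trans (Abelian.Ext.comp_zero ..)
  exact ⟨fun x y => by rw [key x, key y]⟩

theorem exists_extension (hf : Function.Injective f) (hfg : Function.Exact f g)
    (hg : Function.Surjective g) (hC : ExtVanishes R C D 1) (φ : A →ₗ[R] D) :
    ∃ ψ : B →ₗ[R] D, ψ ∘ₗ f = φ := by
  have hS := shortExact hf hfg hg
  obtain ⟨y, hy⟩ := Abelian.Ext.contravariant_sequence_exact₁ hS (ModuleCat.of R D)
    (Abelian.Ext.mk₀ (ModuleCat.ofHom φ)) (add_comm 1 0) (hC.elim _ _)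
  obtain ⟨ψ, rfl⟩ := Abelian.Ext.addEquiv₀.symm.surjective y
  refine ⟨ψ.hom, ?_⟩
  rw [Abelian.Ext.addEquiv₀_symm_apply, Abelian.Ext.mk₀_comp_mk₀] at hy
  have := Abelian.Ext.addEquiv₀.symm.injective hy
  exact congrArg ModuleCat.Hom.hom this

theorem of_exists_extension (hf : Function.Injective f) (hfg : Function.Exact f g)
    (hg : Function.Surjective g) (hB : ExtVanishes R B D 1)
    (H : ∀ φ : A →ₗ[R] D, ∃ ψ : B →ₗ[R] D, ψ ∘ₗ f = φ) : ExtVanishes R C D 1 := by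
  have hS := shortExact hf hfg hg
  have key (z : Abelian.Ext.{0} (ModuleCat.of R C) (ModuleCat.of R D) 1) : z = 0 := by
    obtain ⟨y, hy⟩ := Abelian.Ext.contravariant_sequence_exact₃ hS (ModuleCat.of R D) z
      (hB.elim _ _) (add_comm 1 0)
    obtain ⟨φ, rfl⟩ := Abelian.Ext.addEquiv₀.symm.surjective y
    obtain ⟨ψ, hψ⟩ := H φ.hom
    have hφ : (ShortComplex.moduleCatMk f g hfg.linearMap_comp_eq_zero).f ≫
        (show (ShortComplex.moduleCatMk f g hfg.linearMap_comp_eq_zero).X₂ ⟶ ModuleCat.of R D from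
          ModuleCat.ofHom ψ) = φ := by
      ext x
      exact LinearMap.congr_fun hψ x
    rw [← hy, ← hφ, Abelian.Ext.addEquiv₀_symm_apply, ← Abelian.Ext.mk₀_comp_mk₀]
    exact hS.extClass_comp_assoc _
  exact ⟨fun x y => by rw [key x, key y]⟩

end LongExactSequence

section Nakayama

variable {R : Type} [CommRing R] [IsNoetherianRing R] [IsLocalRing R] {A D : Type}
  [AddCommGroup A] [Module R A] [AddCommGroup D] [Module R D] [Module.Finite R A]
  [Module.Finite R D]

theorem of_quotSMulTop {x : R} (hx : x ∈ maximalIdeal R) (hreg : IsSMulRegular A x) {i : ℕ}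
    (h : ExtVanishes R (QuotSMulTop x A) D (i + 1)) : ExtVanishes R A D i := by
  have hS := hreg.smulShortComplex_shortExact (M := ModuleCat.of R A)
  have hfin : Module.Finite R (Abelian.Ext.{0} (ModuleCat.of R A) (ModuleCat.of R D) i) :=
    inferInstance
  have key : (⊤ : Submodule R (Abelian.Ext.{0} (ModuleCat.of R A) (ModuleCat.of R D) i)) ≤ ⊥ := by
    refine Submodule.le_of_le_smul_of_le_jacobson_bot (I := Ideal.span {x}) hfin.fg_top ?_ ?_
    · rw [IsLocalRing.jacobson_eq_maximalIdeal ⊥ bot_ne_top, Ideal.span_singleton_le_iff_mem]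
      exact hx
    · rintro z -
      obtain ⟨y, hy⟩ := Abelian.Ext.contravariant_sequence_exact₁ hS (ModuleCat.of R D) z
        (add_comm 1 i) (h.elim _ _)
      have h2 : z = x • y := by
        rw [← hy]
        exact (congrArg (fun e => Abelian.Ext.comp e y (zero_add i))
          (Abelian.Ext.mk₀_smul x (𝟙 (ModuleCat.of R A)))).trans
          ((Abelian.Ext.smul_comp _ _ _ _).trans
            (congrArg (x • ·) (Abelian.Ext.mk₀_id_comp _)))
      rw [h2, bot_sup_eq]
      exact Submodule.smul_mem_smul (Ideal.mem_span_singleton_self x) trivial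
  exact ⟨fun a b => by
    rw [(Submodule.mem_bot R).1 (key (x := a) trivial), (Submodule.mem_bot R).1 (key (x := b) trivial)]⟩

end Nakayama

end ExtVanishes
section DerivedFunctor

variable {R : Type} [CommRing R] {A B : Type} [AddCommGroup A] [Module R A]
  [AddCommGroup B] [Module R B]

theorem subsingleton_extGroup_iff_exactAt {X : ModuleCat.{0} R} (P : ProjectiveResolution X)
    (Y : ModuleCat.{0} R) (i : ℕ) :
    Subsingleton (((Ext R (ModuleCat R) i).obj (Opposite.op X)).obj Y) ↔
      (P.complex.linearYonedaObj R Y).ExactAt i := by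
  rw [← ModuleCat.isZero_iff_subsingleton, (P.isoExt i Y).isZero_iff,
    HomologicalComplex.exactAt_iff_isZero_homology]

theorem subsingleton_extGroup_succ_iff {X : ModuleCat.{0} R} (P : ProjectiveResolution X)
    (Y : ModuleCat.{0} R) (i : ℕ) :
    Subsingleton (((Ext R (ModuleCat R) (i + 1)).obj (Opposite.op X)).obj Y) ↔
      ∀ f : P.complex.X (i + 1) ⟶ Y, P.complex.d (i + 2) (i + 1) ≫ f = 0 →
        ∃ g : P.complex.X i ⟶ Y, P.complex.d (i + 1) i ≫ g = f := by
  rw [subsingleton_extGroup_iff_exactAt P,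
    HomologicalComplex.exactAt_iff' _ i (i + 1) (i + 2) (by simp) (by simp),
    ShortComplex.moduleCat_exact_iff]
  rfl

theorem subsingleton_extGroup_zero_iff {X : ModuleCat.{0} R} (P : ProjectiveResolution X)
    (Y : ModuleCat.{0} R) :
    Subsingleton (((Ext R (ModuleCat R) 0).obj (Opposite.op X)).obj Y) ↔
      ∀ f : P.complex.X 0 ⟶ Y, P.complex.d 1 0 ≫ f = 0 → f = 0 := by
  rw [subsingleton_extGroup_iff_exactAt P,
    HomologicalComplex.exactAt_iff' _ 0 0 1 (by simp) (by simp),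
    ShortComplex.moduleCat_exact_iff]
  refine forall_congr' fun f => imp_congr_right fun _ => ⟨?_, fun h => ⟨0, ?_⟩⟩
  · rintro ⟨g, hg⟩
    rw [← hg]
    have : (P.complex.linearYonedaObj R Y).d 0 0 = 0 :=
      HomologicalComplex.shape _ _ _ (by simp)
    change (P.complex.linearYonedaObj R Y).d 0 0 g = 0
    rw [this]
    rfl
  · exact (map_zero _).trans h.symm

theorem extVanishes_iff (i : ℕ) : ExtVanishes R A B i ↔ Subsingleton (extGroup R i A B) := by
  let P := ProjectiveResolution.of (ModuleCat.of R A)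
  cases i with
  | zero =>
    rw [subsingleton_extGroup_zero_iff P, ExtVanishes.zero_iff]
    obtain ⟨p, hp, hd, hdesc⟩ : ∃ p : P.complex.X 0 ⟶ ModuleCat.of R A, Epi p ∧
        P.complex.d 1 0 ≫ p = 0 ∧
        ∀ f : P.complex.X 0 ⟶ ModuleCat.of R B, P.complex.d 1 0 ≫ f = 0 →
          ∃ g : ModuleCat.of R A ⟶ ModuleCat.of R B, p ≫ g = f :=
      ⟨P.π.f 0, inferInstanceAs (Epi (P.π.f 0)), P.complex_d_comp_π_f_zero,
        fun f hf => ⟨P.exact₀.desc f hf, P.exact₀.g_desc f hf⟩⟩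
    constructor
    · intro h f hf
      obtain ⟨g, hg⟩ := hdesc f hf
      have : g = 0 := ModuleCat.hom_ext (Subsingleton.elim _ _)
      rw [← hg, this, Limits.comp_zero]
    · intro h
      have key (g : A →ₗ[R] B) : g = 0 := by
        have h1 := h (p ≫ ModuleCat.ofHom g) (by rw [← Category.assoc, hd, Limits.zero_comp])
        have h2 : ModuleCat.ofHom g = 0 := by rw [← cancel_epi p, h1, Limits.comp_zero]
        exact congrArg ModuleCat.Hom.hom h2
      exact ⟨fun x y => by rw [key x, key y]⟩
  | succ i =>
    rw [subsingleton_extGroup_succ_iff P]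
    constructor
    · intro h f hf
      exact (P.extMk_eq_zero_iff f (i + 2) rfl hf i rfl).1 (h.elim _ _)
    · intro h
      have key (z : Abelian.Ext.{0} (ModuleCat.of R A) (ModuleCat.of R B) (i + 1)) : z = 0 := by
        obtain ⟨f, hf, rfl⟩ := P.extMk_surjective z (i + 2) rfl
        exact (P.extMk_eq_zero_iff f (i + 2) rfl hf i rfl).2 (h f hf)
      exact ⟨fun x y => by rw [key x, key y]⟩

end DerivedFunctor

section Dimension

variable {R : Type} [CommRing R]

theorem hasProjectiveDimensionLE_of_hasPdLE (k : ℕ) (A : Type) [AddCommGroup A] [Module R A]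
    (h : hasPdLE R k A) : HasProjectiveDimensionLE (ModuleCat.of R A) k := by
  induction k generalizing A with
  | zero =>
    exact (projective_iff_hasProjectiveDimensionLT_one).1
      ((IsProjective.iff_projective A).1 h)
  | succ k ih =>
    obtain ⟨P, _, _, f, hP, hf, hk⟩ := h
    have hS := LinearMap.shortExact_shortComplexKer hf
    have : Projective f.shortComplexKer.X₂ := (IsProjective.iff_projective P).1 hP
    exact (hS.hasProjectiveDimensionLT_X₃_iff k this).2 (ih _ hk)

theorem hasInjectiveDimensionLE_of_hasInjDimLE (k : ℕ) (A : Type) [AddCommGroup A] [Module R A]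
    (h : hasInjDimLE R k A) : HasInjectiveDimensionLE (ModuleCat.of R A) k := by
  induction k generalizing A with
  | zero =>
    exact (injective_iff_hasInjectiveDimensionLT_one).1
      ((Module.injective_iff_injective_object R A).1 h)
  | succ k ih =>
    obtain ⟨I, _, _, f, hI, hf, hk⟩ := h
    have hS := ExtVanishes.shortExact hf (LinearMap.exact_map_mkQ_range f)
      (Submodule.mkQ_surjective _)
    have hinj := (Module.injective_iff_injective_object R I).1 hI
    exact (hS.hasInjectiveDimensionLT_X₃_iff k hinj).1 (ih _ hk)

theorem ExtVanishes.of_hasInjectiveDimensionLE {A W : Type} [AddCommGroup A] [Module R A]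
    [AddCommGroup W] [Module R W] {r i : ℕ}
    (h : HasInjectiveDimensionLE (ModuleCat.of R W) r) (hi : r < i) : ExtVanishes R A W i :=
  HasInjectiveDimensionLT.subsingleton (ModuleCat.of R W) (r + 1) i hi _

end Dimension

namespace ExtVanishes

open scoped Pointwise in
theorem of_quotSMulTop_of_isSMulRegular {R : Type} [CommRing R] {A D : Type} [AddCommGroup A]
    [Module R A] [AddCommGroup D] [Module R D] {x : R} (hreg : IsSMulRegular A x) {i : ℕ}
    (h : ExtVanishes R A D i) (h' : ExtVanishes R A D (i + 1)) :
    ExtVanishes R (QuotSMulTop x A) D (i + 1) := by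
  have hfg : Function.Exact (LinearMap.lsmul R A x) (Submodule.mkQ (x • (⊤ : Submodule R A))) := by
    rw [LinearMap.exact_iff, Submodule.ker_mkQ]
    ext y
    simp [Submodule.mem_smul_pointwise_iff_exists]
  exact right (f := LinearMap.lsmul R A x) hreg hfg (Submodule.mkQ_surjective _) h h'

theorem of_subsingleton {R : Type} [CommRing R] {A D : Type} [AddCommGroup A]
    [Module R A] [AddCommGroup D] [Module R D] [Subsingleton A] (i : ℕ) : ExtVanishes R A D i := by
  cases i with
  | zero => exact zero_iff.2 inferInstance
  | succ i => exact of_projective i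

section Bass

variable {S : Type} [CommRing S] [IsNoetherianRing S] [IsLocalRing S] {W : Type}
  [AddCommGroup W] [Module S W]

theorem exists_residueField_embedding_of_supportDim_le (m j : ℕ) (A : Type)
    [AddCommGroup A] [Module S A] [Module.Finite S A] [Nontrivial A] (hA : Module.supportDim S A ≤ m)
    (hV : ∀ i, j < i → ExtVanishes S A W i) :
    ∃ (A' : Type) (_ : AddCommGroup A') (_ : Module S A') (f : (S ⧸ maximalIdeal S) →ₗ[S] A'),
      Module.Finite S A' ∧ Function.Injective f ∧ ∀ i, j + m < i → ExtVanishes S A' W i := by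
  have hsimple : IsSimpleModule S (S ⧸ maximalIdeal S) :=
    isSimpleModule_iff_quot_maximal.2 ⟨_, inferInstance, ⟨LinearEquiv.refl _ _⟩⟩
  induction m generalizing j A with
  | zero =>
    by_cases hs : Subsingleton ((S ⧸ maximalIdeal S) →ₗ[S] A)
    · obtain ⟨x, hx, hreg⟩ := IsSMulRegular.subsingleton_linearMap_iff.1 hs
      rw [Ideal.annihilator_quotient] at hx
      have hdim := Module.supportDim_quotSMulTop_succ_eq_supportDim hreg hx
      have : Nontrivial (QuotSMulTop x A) := nontrivial_quotSMulTop_of_mem_maximalIdeal A hx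
      have h0 := (Module.supportDim_ne_bot_iff_nontrivial S (QuotSMulTop x A)).2 this
      exfalso
      rw [← hdim] at hA
      generalize Module.supportDim S (QuotSMulTop x A) = e at hA h0
      induction e with
      | bot => exact h0 rfl
      | coe e => 
        have := WithBot.coe_le_coe.1 (show ((e + 1 : ℕ∞) : WithBot ℕ∞) ≤ ((0 : ℕ∞) : WithBot ℕ∞) from hA)
        simp at this
    · rw [not_subsingleton_iff_nontrivial] at hs
      obtain ⟨f, hf⟩ := exists_ne (0 : (S ⧸ maximalIdeal S) →ₗ[S] A)
      exact ⟨A, _, _, f, inferInstance, f.injective_or_eq_zero.resolve_right hf, hV⟩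
  | succ m ih =>
    by_cases hs : Subsingleton ((S ⧸ maximalIdeal S) →ₗ[S] A)
    · obtain ⟨x, hx, hreg⟩ := IsSMulRegular.subsingleton_linearMap_iff.1 hs
      rw [Ideal.annihilator_quotient] at hx
      have hdim := Module.supportDim_quotSMulTop_succ_eq_supportDim hreg hx
      have : Nontrivial (QuotSMulTop x A) := nontrivial_quotSMulTop_of_mem_maximalIdeal A hx
      obtain ⟨A', _, _, f, h1, h2, h3⟩ := ih (j + 1) (QuotSMulTop x A) (by
          rw [← hdim] at hA
          generalize Module.supportDim S (QuotSMulTop x A) = e at hA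
          induction e with
          | bot => exact bot_le
          | coe e =>
            have := WithBot.coe_le_coe.1
              (show ((e + 1 : ℕ∞) : WithBot ℕ∞) ≤ ((m + 1 : ℕ∞) : WithBot ℕ∞) from hA)
            exact WithBot.coe_le_coe.2 (ENat.add_le_add_iff_right (by simp) |>.1 this))
        (fun i hi => by
          obtain ⟨i, rfl⟩ : ∃ l, i = l + 1 := ⟨i - 1, by omega⟩
          exact of_quotSMulTop_of_isSMulRegular hreg (hV _ (by omega)) (hV _ (by omega)))
      exact ⟨A', _, _, f, h1, h2, fun i hi => h3 i (by omega)⟩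
    · rw [not_subsingleton_iff_nontrivial] at hs
      obtain ⟨f, hf⟩ := exists_ne (0 : (S ⧸ maximalIdeal S) →ₗ[S] A)
      exact ⟨A, _, _, f, inferInstance, f.injective_or_eq_zero.resolve_right hf,
        fun i hi => hV i (by omega)⟩

theorem exists_residueField_embedding {h : ℕ} (hdim : ringKrullDim S ≤ h) :
    ∃ (A' : Type) (_ : AddCommGroup A') (_ : Module S A') (f : (S ⧸ maximalIdeal S) →ₗ[S] A'),
      Module.Finite S A' ∧ Function.Injective f ∧ ∀ i, h < i → ExtVanishes S A' W i := by
  obtain ⟨A', _, _, f, h1, h2, h3⟩ := exists_residueField_embedding_of_supportDim_le (S := S) (W := W) h 0 S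
    (by rwa [Module.supportDim_self_eq_ringKrullDim])
    (fun i hi => by
      obtain ⟨i, rfl⟩ : ∃ l, i = l + 1 := ⟨i - 1, by omega⟩
      exact of_projective i)
  exact ⟨A', _, _, f, h1, h2, fun i hi => h3 i (by omega)⟩

variable [Module.Finite S W]

theorem of_residueField {r : ℕ}
    (h1 : ∀ (A : Type) [AddCommGroup A] [Module S A] [Module.Finite S A],
      ExtVanishes S A W (r + 1))
    (h2 : ExtVanishes S (S ⧸ maximalIdeal S) W r)
    (A : Type) [AddCommGroup A] [Module S A] [Module.Finite S A] : ExtVanishes S A W r := by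
  induction ‹Module.Finite S A› using
    IsNoetherianRing.induction_on_isQuotientEquivQuotientPrime S with
  | subsingleton N => exact of_subsingleton r
  | quotient N p f =>
    by_cases hp : p.asIdeal = maximalIdeal S
    · exact of_linearEquiv_left ((Submodule.quotEquivOfEq _ _ hp.symm).trans f.symm) h2
    · obtain ⟨x, hx, hxp⟩ := SetLike.exists_of_lt
        (lt_of_le_of_ne (IsLocalRing.le_maximalIdeal p.isPrime.ne_top) hp)
      have hreg : IsSMulRegular (S ⧸ p.asIdeal) x := by
        refine isSMulRegular_quotient_iff_mem_of_smul_mem _ _ |>.2 fun y hy => ?_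
        exact (p.isPrime.mem_or_mem hy).resolve_left hxp
      exact of_linearEquiv_left f.symm (of_quotSMulTop hx hreg (h1 _))
  | exact N₁ N₂ N₃ f g hf hg hfg h₁ h₃ => exact middle hf hfg hg h₁ h₃

theorem of_ringKrullDim_lt {h r : ℕ} (hdim : ringKrullDim S ≤ h)
    (hr : HasInjectiveDimensionLE (ModuleCat.of S W) r) (A : Type) [AddCommGroup A] [Module S A]
    [Module.Finite S A] {i : ℕ} (hi : h < i) : ExtVanishes S A W i := by
  obtain ⟨A', _, _, f, h1, h2, h3⟩ := exists_residueField_embedding (S := S) (W := W) hdim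
  have key (t : ℕ) : ∀ i, h < i → r < i + t → ∀ (A : Type) [AddCommGroup A] [Module S A]
      [Module.Finite S A], ExtVanishes S A W i := by
    induction t with
    | zero =>
      intro i _ hir A _ _ _
      exact of_hasInjectiveDimensionLE hr hir
    | succ t ih =>
      intro i hi hir A _ _ _
      refine of_residueField (fun B _ _ _ => ih (i + 1) (by omega) (by omega) B) ?_ A
      exact left h2 (LinearMap.exact_map_mkQ_range f) (Submodule.mkQ_surjective _)
        (h3 i hi) (ih (i + 1) (by omega) (by omega) _)
  exact key (r + 1) i hi (by omega) A

theorem of_isWeaklyRegular {h : ℕ}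
    (high : ∀ (A : Type) [AddCommGroup A] [Module S A] [Module.Finite S A] (i : ℕ), h < i →
      ExtVanishes S A W i) (rs : List S) (N : Type) [AddCommGroup N] [Module S N]
    [Module.Finite S N] (hrs : ∀ x ∈ rs, x ∈ maximalIdeal S)
    (hreg : RingTheory.Sequence.IsWeaklyRegular N rs) {i : ℕ} (hi : h < i + rs.length) :
    ExtVanishes S N W i := by
  induction rs generalizing N i with
  | nil => exact high N i hi
  | cons x rs ih =>
    rw [RingTheory.Sequence.isWeaklyRegular_cons_iff] at hreg
    refine of_quotSMulTop (hrs x (by simp)) hreg.1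
      (ih _ (fun y hy => hrs y (by simp [hy])) hreg.2 ?_)
    simp only [List.length_cons] at hi
    omega

end Bass

section Annihilator

variable {R : Type} [CommRing R] {A D : Type} [AddCommGroup A] [Module R A]
  [AddCommGroup D] [Module R D]

theorem range_lsmul {a : R} (ha : a ∈ Module.annihilator R D) {i : ℕ}
    (h1 : ExtVanishes R (A ⧸ LinearMap.range (LinearMap.lsmul R A a)) D (i + 2))
    (h2 : ExtVanishes R (LinearMap.ker (LinearMap.lsmul R A a)) D i) :
    ExtVanishes R (LinearMap.range (LinearMap.lsmul R A a)) D (i + 1) := by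
  set φ := LinearMap.lsmul R A a
  have hS1 := shortExact (f := (LinearMap.range φ).subtype) (g := (LinearMap.range φ).mkQ)
    (Submodule.subtype_injective _) (LinearMap.exact_subtype_mkQ _) (Submodule.mkQ_surjective _)
  have hS2 := shortExact (f := (LinearMap.ker φ).subtype) (g := φ.rangeRestrict)
    (Submodule.subtype_injective _) (by
      rw [LinearMap.exact_iff, LinearMap.ker_rangeRestrict, Submodule.range_subtype])
    φ.surjective_rangeRestrict
  have key (z : Abelian.Ext.{0} (ModuleCat.of R (LinearMap.range φ)) (ModuleCat.of R D) (i + 1)) :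
      z = 0 := by
    obtain ⟨z', hz'⟩ : ∃ z' : Abelian.Ext.{0} (ModuleCat.of R A) (ModuleCat.of R D) (i + 1),
        (Abelian.Ext.mk₀ (ModuleCat.ofHom (LinearMap.range φ).subtype)).comp z'
          (zero_add (i + 1)) = z :=
      Abelian.Ext.contravariant_sequence_exact₁ hS1 (ModuleCat.of R D) z
        (add_comm 1 (i + 1)) (h1.elim _ _)
    have hz : (Abelian.Ext.mk₀ (ModuleCat.ofHom φ.rangeRestrict)).comp z (zero_add (i + 1)) = 0 := by
      have h3 : ModuleCat.ofHom φ.rangeRestrict ≫ ModuleCat.ofHom (LinearMap.range φ).subtype =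
          a • 𝟙 (ModuleCat.of R A) := by
        ext x
        rfl
      have h4 : (a • 𝟙 (ModuleCat.of R D)) = 0 := by
        ext x
        exact Module.mem_annihilator.1 ha x
      rw [← hz', Abelian.Ext.mk₀_comp_mk₀_assoc, h3, Abelian.Ext.mk₀_smul,
        Abelian.Ext.smul_comp, Abelian.Ext.mk₀_id_comp, ← Abelian.Ext.comp_mk₀_id z',
        ← Abelian.Ext.comp_smul, ← Abelian.Ext.mk₀_smul, h4, Abelian.Ext.mk₀_zero,
        Abelian.Ext.comp_zero]
    obtain ⟨y, hy⟩ := Abelian.Ext.contravariant_sequence_exact₃ hS2 (ModuleCat.of R D) z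
      hz (add_comm 1 i)
    obtain rfl : y = 0 := h2.elim _ _
    exact hy.symm.trans (Abelian.Ext.comp_zero ..)
  exact ⟨fun x y => by rw [key x, key y]⟩

end Annihilator

end ExtVanishes

/-- The degrees in which `Ext(-, W)` vanishes when `W` is a canonical module of a local ring of
dimension `h`. -/
structure HasCanonicalExt (S : Type) [CommRing S] [IsLocalRing S] (W : Type) [AddCommGroup W]
    [Module S W] (h : ℕ) : Prop where
  high : ∀ (A : Type) [AddCommGroup A] [Module S A] [Module.Finite S A] (i : ℕ), h < i →
    ExtVanishes S A W i
  low : ∀ (A : Type) [AddCommGroup A] [Module S A] [Module.Finite S A] (n : ℕ),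
    maximalIdeal S ^ n ≤ Module.annihilator S A → ∀ i < h, ExtVanishes S A W i
  residueField : ¬ ExtVanishes S (S ⧸ maximalIdeal S) W h

namespace HasCanonicalExt

variable {S : Type} [CommRing S] [IsNoetherianRing S] [IsLocalRing S] {W : Type}
  [AddCommGroup W] [Module S W] {h : ℕ}

theorem subsingleton_of_extVanishes (H : HasCanonicalExt S W (h + 1)) (C : Type) [AddCommGroup C]
    [Module S C] [Module.Finite S C] (n : ℕ) (hC : maximalIdeal S ^ n ≤ Module.annihilator S C)
    (hV : ExtVanishes S C W (h + 1)) : Subsingleton C := by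
  by_contra hs
  rw [not_subsingleton_iff_nontrivial] at hs
  obtain ⟨N, hN, -⟩ := (eq_top_or_exists_le_coatom (⊥ : Submodule S C)).resolve_left bot_ne_top
  obtain ⟨I, hI, ⟨e⟩⟩ := isSimpleModule_iff_quot_maximal.1 (isSimpleModule_iff_isCoatom.2 hN)
  obtain rfl := IsLocalRing.eq_maximalIdeal hI
  refine H.residueField (ExtVanishes.of_linearEquiv_left e ?_)
  refine ExtVanishes.right N.injective_subtype (LinearMap.exact_subtype_mkQ N)
    (Submodule.mkQ_surjective N) ?_ hV
  exact H.low N n (hC.trans (N.subtype.annihilator_le_of_injective N.injective_subtype)) h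
    (Nat.lt_succ_self h)

theorem annihilator_eq_bot (H : HasCanonicalExt S W (h + 1)) : Module.annihilator S W = ⊥ := by
  refine (eq_bot_iff).2 fun a ha => ?_
  rw [← Ideal.iInf_pow_eq_bot_of_isLocalRing (maximalIdeal S) (Ideal.IsPrime.ne_top'),
    Ideal.mem_iInf]
  intro n
  have hann : maximalIdeal S ^ n ≤ Module.annihilator S (S ⧸ maximalIdeal S ^ n) :=
    (Ideal.annihilator_quotient).ge
  have hsub := H.subsingleton_of_extVanishes
    (LinearMap.range (LinearMap.lsmul S (S ⧸ maximalIdeal S ^ n) a)) n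
    (hann.trans (LinearMap.annihilator_le_of_injective _ (Submodule.injective_subtype _)))
    (ExtVanishes.range_lsmul ha (H.high _ _ (by omega))
      (H.low _ n (hann.trans (LinearMap.annihilator_le_of_injective _
        (Submodule.injective_subtype _))) _ (by omega)))
  have h1 : LinearMap.lsmul S (S ⧸ maximalIdeal S ^ n) a (Ideal.Quotient.mk _ 1) = 0 :=
    congrArg Subtype.val (Subsingleton.elim
      (⟨_, LinearMap.mem_range_self _ (Ideal.Quotient.mk _ 1)⟩ :
        LinearMap.range (LinearMap.lsmul S (S ⧸ maximalIdeal S ^ n) a)) 0)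
  rw [← Ideal.Quotient.eq_zero_iff_mem]
  rw [LinearMap.lsmul_apply, ← Ideal.Quotient.mk_eq_mk, ← Submodule.Quotient.mk_smul] at h1
  simpa using h1

end HasCanonicalExt

section Depth

variable {S : Type} [CommRing S] [IsLocalRing S] {N : Type} [AddCommGroup N] [Module S N]

theorem extVanishes_residueField_of_lt_moduleDepth {i : ℕ} (hi : (i : ℕ∞) < moduleDepth S N) :
    ExtVanishes S (S ⧸ maximalIdeal S) N i := by
  rw [extVanishes_iff]
  by_contra hs
  rw [not_subsingleton_iff_nontrivial] at hs
  have : moduleDepth S N ≤ i := sInf_le ⟨i, rfl, hs⟩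
  exact absurd this (not_le.2 hi)

theorem not_extVanishes_residueField {h : ℕ} (hh : moduleDepth S N = h) :
    ¬ ExtVanishes S (S ⧸ maximalIdeal S) N h := by
  intro hV
  have hlt (i : ℕ) (hi : i ≤ h) : ExtVanishes S (S ⧸ maximalIdeal S) N i := by
    rcases hi.lt_or_eq with hi | rfl
    · exact extVanishes_residueField_of_lt_moduleDepth (by rw [hh]; exact_mod_cast hi)
    · exact hV
  have : ((h + 1 : ℕ) : ℕ∞) ≤ moduleDepth S N := by
    refine le_sInf ?_
    rintro _ ⟨k, rfl, hk⟩
    by_contra hlt'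
    have hkh : k ≤ h := by
      have : k < h + 1 := by exact_mod_cast not_le.1 hlt'
      omega
    exact not_subsingleton_iff_nontrivial.2 hk ((extVanishes_iff k).1 (hlt k hkh))
  rw [hh] at this
  have : h + 1 ≤ h := by exact_mod_cast this
  omega

variable [Module.Finite S N]

theorem maximalIdeal_smul_top_lt [Nontrivial N] :
    maximalIdeal S • (⊤ : Submodule S N) < ⊤ :=
  lt_top_iff_ne_top.2 (Ne.symm (Submodule.top_ne_ideal_smul_of_le_jacobson_annihilator
    (maximalIdeal_le_jacobson _)))

variable [IsNoetherianRing S]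

theorem exists_isRegular_of_moduleDepth_eq [Nontrivial N] {h : ℕ} (hh : moduleDepth S N = h) :
    ∃ rs : List S, rs.length = h ∧ (∀ r ∈ rs, r ∈ maximalIdeal S) ∧
      RingTheory.Sequence.IsRegular N rs := by
  refine ModuleCat.exists_isRegular_of_exists_subsingleton_ext (maximalIdeal S) h
    (ModuleCat.of S N) maximalIdeal_smul_top_lt (ModuleCat.of S (S ⧸ maximalIdeal S)) ?_ ?_
  · exact (Module.support_eq_zeroLocus).trans (by rw [Ideal.annihilator_quotient])
  · exact fun i hi => extVanishes_residueField_of_lt_moduleDepth (by rw [hh]; exact_mod_cast hi)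

theorem extVanishes_of_lt_moduleDepth [Nontrivial N] {h : ℕ} (hh : moduleDepth S N = h)
    (A : Type) [AddCommGroup A] [Module S A] [Module.Finite S A] (n : ℕ)
    (hn : maximalIdeal S ^ n ≤ Module.annihilator S A) {i : ℕ} (hi : i < h) :
    ExtVanishes S A N i := by
  obtain ⟨rs, h1, h2, h3⟩ := exists_isRegular_of_moduleDepth_eq (N := N) hh
  refine ModuleCat.subsingleton_ext_of_exists_isRegular (maximalIdeal S) (ModuleCat.of S A) ?_
    (ModuleCat.of S N) maximalIdeal_smul_top_lt rs h2 h3 i (h1 ▸ hi)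
  intro p hp
  have hp' : Module.annihilator S A ≤ p.asIdeal := by
    have := hp
    erw [Module.support_eq_zeroLocus] at this
    exact this
  exact p.isPrime.le_of_pow_le (hn.trans hp')

theorem hasCanonicalExt_of_moduleDepth_eq [Nontrivial N] {h r : ℕ} (hdim : ringKrullDim S = h)
    (hh : moduleDepth S N = h) (hr : HasInjectiveDimensionLE (ModuleCat.of S N) r) :
    HasCanonicalExt S N h where
  high A _ _ _ _ hi := ExtVanishes.of_ringKrullDim_lt hdim.le hr A hi
  low A _ _ _ n hn _ hi := extVanishes_of_lt_moduleDepth hh A n hn hi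
  residueField := not_extVanishes_residueField hh

end Depth

section FiniteProjectiveDimension

variable {S : Type} [CommRing S]

theorem Module.Projective.of_exact_of_retraction {Z F N : Type} [AddCommGroup Z] [Module S Z]
    [AddCommGroup F] [Module S F] [AddCommGroup N] [Module S N] [Module.Projective S F]
    {f : Z →ₗ[S] F} {g : F →ₗ[S] N} (hfg : Function.Exact f g)
    (hg : Function.Surjective g) {r : F →ₗ[S] Z} (hr : r ∘ₗ f = LinearMap.id) :
    Module.Projective S N := by
  have h := hfg.split_tfae'.out 1 0
  obtain ⟨-, l, hl⟩ := h.1 ⟨hg, r, hr⟩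
  exact Module.Projective.of_split l g hl

variable [IsLocalRing S]

theorem exists_retraction_of_forall_exists_extension {Z F W : Type} [AddCommGroup Z] [Module S Z]
    [Module.Finite S Z] [Module.Projective S Z] [AddCommGroup F] [Module S F]
    [Module.Projective S F] [AddCommGroup W] [Module S W] [Module.Finite S W] [Nontrivial W]
    (f : Z →ₗ[S] F) (H : ∀ φ : Z →ₗ[S] W, ∃ ψ : F →ₗ[S] W, ψ ∘ₗ f = φ) :
    ∃ r : F →ₗ[S] Z, r ∘ₗ f = LinearMap.id := by
  have : Module.Free S Z := Module.free_of_flat_of_isLocalRing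
  obtain ⟨N, hN, -⟩ := (eq_top_or_exists_le_coatom (⊥ : Submodule S W)).resolve_left bot_ne_top
  obtain ⟨I, hI, ⟨e⟩⟩ := isSimpleModule_iff_quot_maximal.1 (isSimpleModule_iff_isCoatom.2 hN)
  obtain rfl := IsLocalRing.eq_maximalIdeal hI
  obtain ⟨w, hw⟩ := (e.surjective.comp N.mkQ_surjective) (Ideal.Quotient.mk _ 1)
  let p : W →ₗ[S] S ⧸ maximalIdeal S := e.toLinearMap ∘ₗ N.mkQ
  have hpw : p w = Ideal.Quotient.mk _ 1 := hw
  let b := Module.Free.chooseBasis S Z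
  choose ψ hψ using fun i => H ((b.coord i).smulRight w)
  choose ρ hρ using fun i => Module.projective_lifting_property
    (Submodule.mkQ (maximalIdeal S)) (p ∘ₗ ψ i) (Submodule.mkQ_surjective _)
  let r : F →ₗ[S] Z := ∑ i, (ρ i).smulRight (b i)
  have hmem (z : Z) (i) : b.coord i z - ρ i (f z) ∈ maximalIdeal S := by
    rw [← Submodule.Quotient.mk_eq_zero, Submodule.Quotient.mk_sub, sub_eq_zero]
    have h1 : p (ψ i (f z)) = b.coord i z • Ideal.Quotient.mk _ 1 := by
      rw [← hpw, ← map_smul]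
      exact congrArg p (LinearMap.congr_fun (hψ i) z)
    refine Eq.trans ?_ (h1.symm.trans (LinearMap.congr_fun (hρ i) (f z)).symm)
    rw [← Ideal.Quotient.mk_eq_mk, ← Submodule.Quotient.mk_smul]
    simp
  have hsurj : Function.Surjective (r ∘ₗ f) := by
    rw [← LinearMap.range_eq_top, ← top_le_iff]
    refine Submodule.le_of_le_smul_of_le_jacobson_bot (I := maximalIdeal S)
      Module.Finite.fg_top (IsLocalRing.jacobson_eq_maximalIdeal ⊥ bot_ne_top).ge ?_
    intro z _
    have hz : z = (r ∘ₗ f) z + ∑ i, (b.coord i z - ρ i (f z)) • b i := by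
      simp only [sub_smul, Finset.sum_sub_distrib, r, LinearMap.comp_apply, LinearMap.sum_apply,
        LinearMap.smulRight_apply, add_sub_cancel]
      exact (b.sum_repr z).symm
    rw [hz]
    exact Submodule.add_mem_sup (LinearMap.mem_range_self _ _)
      (Submodule.sum_mem _ fun i _ => Submodule.smul_mem_smul (hmem z i) trivial)
  let E := LinearEquiv.ofBijective (r ∘ₗ f)
    ⟨OrzechProperty.injective_of_surjective_endomorphism _ hsurj, hsurj⟩
  refine ⟨E.symm.toLinearMap ∘ₗ r, LinearMap.ext fun z => ?_⟩
  exact E.symm_apply_apply z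

variable [IsNoetherianRing S]

/-- A module of finite projective dimension with no higher extensions by some nonzero finitely
generated module is projective. -/
theorem projective_of_hasProjectiveDimensionLE {W : Type} [AddCommGroup W] [Module S W]
    [Module.Finite S W] [Nontrivial W] (k : ℕ) (N : Type) [AddCommGroup N] [Module S N]
    [Module.Finite S N] (hN : HasProjectiveDimensionLE (ModuleCat.of S N) k)
    (hV : ∀ i, ExtVanishes S N W (i + 1)) : Module.Projective S N := by
  induction k generalizing N with
  | zero =>
    exact (IsProjective.iff_projective N).2 (projective_iff_hasProjectiveDimensionLT_one.2 hN)
  | succ k ih =>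
    obtain ⟨n, f, hf⟩ := Module.Finite.exists_fin' S N
    have hfg : Function.Exact (LinearMap.ker f).subtype f := by
      rw [LinearMap.exact_iff, Submodule.range_subtype]
    have hS := ExtVanishes.shortExact (LinearMap.ker f).injective_subtype hfg hf
    have hF : Projective (ModuleCat.of S (Fin n → S)) :=
      (IsProjective.iff_projective (Fin n → S)).1 inferInstance
    have hZ : Module.Projective S (LinearMap.ker f) :=
      ih _ ((hS.hasProjectiveDimensionLT_X₃_iff k hF).1 hN) fun i =>
        ExtVanishes.left (LinearMap.ker f).injective_subtype hfg hf
          (ExtVanishes.of_projective i) (hV (i + 1))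
    obtain ⟨r, hr⟩ := exists_retraction_of_forall_exists_extension (W := W)
      (LinearMap.ker f).subtype
      (ExtVanishes.exists_extension (LinearMap.ker f).injective_subtype hfg hf (hV 0))
    exact Module.Projective.of_exact_of_retraction hfg hf hr

end FiniteProjectiveDimension

section FactorIdeal

variable (S : Type) [CommRing S] (N : Type) [AddCommGroup N] [Module S N]

/-- The ideal of scalars whose action on `N` factors through a finite free module. -/
def freeFactorIdeal : Ideal S :=
  (LinearMap.range (dualTensorHom S N N)).comap (LinearMap.toSpanSingleton S _ LinearMap.id)

variable {S N}

theorem mem_freeFactorIdeal {s : S} : s ∈ freeFactorIdeal S N ↔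
    s • (LinearMap.id : N →ₗ[S] N) ∈ LinearMap.range (dualTensorHom S N N) := Iff.rfl

theorem exists_factorization_of_mem_range_dualTensorHom {φ : N →ₗ[S] N}
    (hφ : φ ∈ LinearMap.range (dualTensorHom S N N)) :
    ∃ (n : ℕ) (f : N →ₗ[S] (Fin n → S)) (y : Fin n → N),
      ∀ x, ∑ j, f x j • y j = φ x := by
  obtain ⟨t, rfl⟩ := hφ
  obtain ⟨n, f, y, rfl⟩ := TensorProduct.exists_sum_tmul_eq t
  exact ⟨n, LinearMap.pi f, y, fun x => by simp [dualTensorHom_apply]⟩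

theorem projective_of_id_mem_range_dualTensorHom
    (h : LinearMap.id ∈ LinearMap.range (dualTensorHom S N N)) : Module.Projective S N := by
  obtain ⟨n, f, y, hy⟩ := exists_factorization_of_mem_range_dualTensorHom h
  exact Module.Projective.of_split f (Fintype.linearCombination S y) (LinearMap.ext hy)

theorem smul_eq_zero_of_mem_freeFactorIdeal {s : S} (hs : s ∈ freeFactorIdeal S N) {Z F : Type}
    [AddCommGroup Z] [Module S Z] [AddCommGroup F] [Module S F] {f : Z →ₗ[S] F}
    (hf : Function.Injective f) {t : Z ⊗[S] N} (ht : f.rTensor N t = 0) : s • t = 0 := by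
  obtain ⟨n, p, y, hy⟩ := exists_factorization_of_mem_range_dualTensorHom hs
  have h1 : (Fintype.linearCombination S y) ∘ₗ p = s • LinearMap.id := LinearMap.ext hy
  have h2 : p.lTensor Z t = 0 := by
    apply Module.Flat.rTensor_preserves_injective_linearMap (M := Fin n → S) f hf
    rw [map_zero, ← LinearMap.comp_apply, LinearMap.rTensor_comp_lTensor,
      ← LinearMap.lTensor_comp_rTensor, LinearMap.comp_apply, ht, map_zero]
  have h3 := congrArg (fun φ : N →ₗ[S] N => φ.lTensor Z t) h1
  simp only [LinearMap.lTensor_comp, LinearMap.comp_apply, h2, map_zero, LinearMap.lTensor_smul,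
    LinearMap.lTensor_id, LinearMap.smul_apply, LinearMap.id_apply] at h3
  exact h3.symm

theorem smul_mem_range_dualTensorHom {s : S} (hs : s ∈ freeFactorIdeal S N) (φ : N →ₗ[S] N) :
    s • φ ∈ LinearMap.range (dualTensorHom S N N) := by
  obtain ⟨n, p, y, hy⟩ := exists_factorization_of_mem_range_dualTensorHom hs
  refine ⟨∑ j, (LinearMap.proj j ∘ₗ p) ⊗ₜ φ (y j), LinearMap.ext fun x => ?_⟩
  have := congrArg φ (hy x)
  simpa [dualTensorHom_apply] using this

theorem smul_eq_zero_of_dualTensorHom_eq_zero {s : S} (hs : s ∈ freeFactorIdeal S N)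
    {t : Module.Dual S N ⊗[S] N} (ht : dualTensorHom S N N t = 0) : s • t = 0 := by
  obtain ⟨n, p, y, hy⟩ := exists_factorization_of_mem_range_dualTensorHom hs
  have key (t : Module.Dual S N ⊗[S] N) :
      ∑ j, ((LinearMap.proj j ∘ₗ p) ∘ₗ dualTensorHom S N N t) ⊗ₜ[S] y j = s • t := by
    induction t with
    | zero => simp
    | add a b ha hb =>
      rw [smul_add, ← ha, ← hb, ← Finset.sum_add_distrib]
      exact Finset.sum_congr rfl fun j _ => by
        rw [map_add, LinearMap.comp_add, TensorProduct.add_tmul]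
    | tmul α x =>
      have h1 : s • (α ⊗ₜ[S] x) = α ⊗ₜ[S] (s • x) := (TensorProduct.tmul_smul s α x).symm
      rw [h1, show s • x = ∑ j, p x j • y j from (hy x).symm, TensorProduct.tmul_sum]
      refine Finset.sum_congr rfl fun j _ => ?_
      rw [TensorProduct.tmul_smul, TensorProduct.smul_tmul']
      congr 1
      ext z
      simp [dualTensorHom_apply, mul_comm]
  rw [← key t, ht]
  simp

end FactorIdeal

namespace ExtVanishes

variable {S : Type} [CommRing S] {N W : Type} [AddCommGroup N] [Module S N] [AddCommGroup W]
  [Module S W]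

theorem pi_fin {i : ℕ} (h : ExtVanishes S N W i) (n : ℕ) : ExtVanishes S (Fin n → N) W i := by
  induction n with
  | zero => exact of_subsingleton i
  | succ n ih =>
    exact of_linearEquiv_left (Fin.consLinearEquiv S fun _ => N)
      (middle LinearMap.inl_injective Function.Exact.inl_snd LinearMap.snd_surjective h ih)

theorem pi_fin_tensor {i : ℕ} (h : ExtVanishes S N W i) (n : ℕ) :
    ExtVanishes S ((Fin n → S) ⊗[S] N) W i :=
  of_linearEquiv_left ((TensorProduct.comm S _ _).trans
    (TensorProduct.piScalarRight S S N (Fin n))).symm (pi_fin h n)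

end ExtVanishes

namespace ExtVanishes

variable {R : Type} [CommRing R] {A B C D : Type} [AddCommGroup A] [Module R A]
  [AddCommGroup B] [Module R B] [AddCommGroup C] [Module R C] [AddCommGroup D] [Module R D]
  {f : A →ₗ[R] B} {g : B →ₗ[R] C}

theorem _root_.Function.Exact.subtype_range (hfg : Function.Exact f g) :
    Function.Exact (LinearMap.range f).subtype g := by
  rw [LinearMap.exact_iff, Submodule.range_subtype, hfg.linearMap_ker_eq]

theorem range {i : ℕ} (hker : ExtVanishes R (LinearMap.ker f) D i)
    (hA : ExtVanishes R A D (i + 1)) : ExtVanishes R (LinearMap.range f) D (i + 1) := by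
  refine right (LinearMap.ker f).injective_subtype (g := f.rangeRestrict) ?_
    f.surjective_rangeRestrict hker hA
  rw [LinearMap.exact_iff, LinearMap.ker_rangeRestrict, Submodule.range_subtype]

theorem of_forall_exists_comp_eq (hfg : Function.Exact f g) (hg : Function.Surjective g)
    (hB : ExtVanishes R B D 1)
    (H : ∀ φ : A →ₗ[R] D, ∃ ψ : B →ₗ[R] D, ψ ∘ₗ f = φ) : ExtVanishes R C D 1 := by
  refine of_exists_extension (LinearMap.range f).injective_subtype hfg.subtype_range hg hB
    fun φ => ?_
  obtain ⟨ψ, hψ⟩ := H (φ ∘ₗ f.rangeRestrict)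
  refine ⟨ψ, LinearMap.ext ?_⟩
  rintro ⟨_, t, rfl⟩
  exact LinearMap.congr_fun hψ t

end ExtVanishes

section LocalCriterion

variable {S : Type} [CommRing S] [IsNoetherianRing S] [IsLocalRing S] {W : Type}
  [AddCommGroup W] [Module S W] {h : ℕ}

theorem HasCanonicalExt.range (H : HasCanonicalExt S W h) {A B : Type} [AddCommGroup A]
    [Module S A] [Module.Finite S A] [AddCommGroup B] [Module S B] (f : A →ₗ[S] B) {k i : ℕ}
    (hf : ∀ s ∈ maximalIdeal S ^ k, ∀ t, f t = 0 → s • t = 0) (hi : i < h)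
    (hA : ExtVanishes S A W (i + 1)) : ExtVanishes S (LinearMap.range f) W (i + 1) := by
  refine ExtVanishes.range (H.low _ k (fun s hs => Module.mem_annihilator.2 ?_) i hi) hA
  rintro ⟨t, ht⟩
  exact Subtype.ext (hf s hs t ht)

theorem HasCanonicalExt.right (H : HasCanonicalExt S W h) {A B C : Type} [AddCommGroup A]
    [Module S A] [Module.Finite S A] [AddCommGroup B] [Module S B] [AddCommGroup C] [Module S C]
    {f : A →ₗ[S] B} {g : B →ₗ[S] C} (hfg : Function.Exact f g) (hg : Function.Surjective g)
    {k i : ℕ} (hf : ∀ s ∈ maximalIdeal S ^ k, ∀ t, f t = 0 → s • t = 0) (hi : i < h)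
    (hA : ExtVanishes S A W (i + 1)) (hB : ExtVanishes S B W (i + 2)) :
    ExtVanishes S C W (i + 2) :=
  ExtVanishes.right (LinearMap.range f).injective_subtype hfg.subtype_range hg
    (H.range f hf hi hA) hB

variable {N : Type} [AddCommGroup N] [Module S N] [Module.Finite S N]

theorem HasCanonicalExt.tensor (H : HasCanonicalExt S W h) {k : ℕ}
    (hk : maximalIdeal S ^ k ≤ freeFactorIdeal S N) (hN : ∀ i, ExtVanishes S N W (i + 1)) (j : ℕ)
    (hj : j + 1 < h) (A : Type) [AddCommGroup A] [Module S A] [Module.Finite S A]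
    (hA : ExtVanishes S A (N →ₗ[S] W) (j + 1)) : ExtVanishes S (A ⊗[S] N) W (j + 1) := by
  induction j generalizing A with
  | zero =>
    obtain ⟨n, p, hp⟩ := Module.Finite.exists_fin' S A
    have hex : Function.Exact (LinearMap.ker p).subtype p := by
      rw [LinearMap.exact_iff, Submodule.range_subtype]
    refine ExtVanishes.of_forall_exists_comp_eq (rTensor_exact N hex hp)
      (LinearMap.rTensor_surjective N hp) (ExtVanishes.pi_fin_tensor (hN 0) n) fun φ => ?_
    obtain ⟨ψ, hψ⟩ := ExtVanishes.exists_extension (LinearMap.ker p).injective_subtype hex hp hA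
      (TensorProduct.curry φ)
    refine ⟨TensorProduct.lift ψ, TensorProduct.ext' fun z x => ?_⟩
    exact LinearMap.congr_fun (LinearMap.congr_fun hψ z) x
  | succ j ih =>
    obtain ⟨n, p, hp⟩ := Module.Finite.exists_fin' S A
    have hex : Function.Exact (LinearMap.ker p).subtype p := by
      rw [LinearMap.exact_iff, Submodule.range_subtype]
    have hinj := (LinearMap.ker p).injective_subtype
    have hZ := ih (by omega) (LinearMap.ker p) (ExtVanishes.left hinj hex hp
      (ExtVanishes.of_projective j) hA)
    exact H.right (rTensor_exact N hex hp) (LinearMap.rTensor_surjective N hp) (k := k)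
      (fun s hs t ht => smul_eq_zero_of_mem_freeFactorIdeal (hk hs) hinj ht) (by omega) hZ
      (ExtVanishes.pi_fin_tensor (hN (j + 1)) n)

theorem HasCanonicalExt.surjective (H : HasCanonicalExt S W (h + 2)) {A B : Type}
    [AddCommGroup A] [Module S A] [Module.Finite S A] [AddCommGroup B] [Module S B]
    [Module.Finite S B] (f : A →ₗ[S] B) (k : ℕ)
    (hker : ∀ s ∈ maximalIdeal S ^ k, ∀ t, f t = 0 → s • t = 0)
    (hcoker : ∀ s ∈ maximalIdeal S ^ k, ∀ b, s • b ∈ LinearMap.range f)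
    (hA : ExtVanishes S A W (h + 1)) (hB : ExtVanishes S B W (h + 2)) :
    Function.Surjective f := by
  have hC : ExtVanishes S (B ⧸ LinearMap.range f) W (h + 2) :=
    H.right (LinearMap.exact_map_mkQ_range f) (Submodule.mkQ_surjective _) hker (by omega) hA hB
  have hsub := H.subsingleton_of_extVanishes _ k (fun s hs => Module.mem_annihilator.2 fun q => by
    obtain ⟨b, rfl⟩ := Submodule.mkQ_surjective _ q
    rw [← map_smul]
    exact (Submodule.Quotient.mk_eq_zero _).2 (hcoker s hs b)) hC
  exact LinearMap.range_eq_top.1 (Submodule.Quotient.subsingleton_iff.1 hsub)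

/-- A module that is free on the punctured spectrum, of depth `h + 2`, is projective as soon as
`Ext^{h+1}` of its dual by its canonical dual vanishes. -/
theorem HasCanonicalExt.projective [Module.Finite S W] (H : HasCanonicalExt S W (h + 2)) {k : ℕ}
    (hk : maximalIdeal S ^ k ≤ freeFactorIdeal S N) {rs : List S} (hrs : rs.length = h + 2)
    (hmem : ∀ x ∈ rs, x ∈ maximalIdeal S) (hreg : RingTheory.Sequence.IsWeaklyRegular N rs)
    (hV : ExtVanishes S (Module.Dual S N) (N →ₗ[S] W) (h + 1)) : Module.Projective S N := by
  have hN (i : ℕ) : ExtVanishes S N W (i + 1) :=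
    ExtVanishes.of_isWeaklyRegular H.high rs N hmem hreg (by omega)
  have hV' := H.tensor hk hN h (by omega) _ hV
  have hEnd : ExtVanishes S (N →ₗ[S] N) W (h + 2) := by
    obtain ⟨x, rs, rfl⟩ : ∃ x l, rs = x :: l := List.exists_cons_of_length_eq_add_one hrs
    have hx := (RingTheory.Sequence.isWeaklyRegular_cons_iff N x rs).1 hreg |>.1
    refine ExtVanishes.of_quotSMulTop (hmem x (by simp)) (fun f g hfg => ?_)
      (H.high _ _ (by omega))
    exact LinearMap.ext fun y => hx (LinearMap.congr_fun hfg y)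
  have hsurj : Function.Surjective (dualTensorHom S N N) :=
    H.surjective (A := Module.Dual S N ⊗[S] N) (B := N →ₗ[S] N) (dualTensorHom S N N) k
      (fun s hs t ht => smul_eq_zero_of_dualTensorHom_eq_zero (hk hs) ht)
      (fun s hs φ => smul_mem_range_dualTensorHom (hk hs) φ) hV' hEnd
  obtain ⟨t, ht⟩ := hsurj LinearMap.id
  exact projective_of_id_mem_range_dualTensorHom ⟨t, ht⟩

end LocalCriterion

section Localization

open IsLocalizedModule (mapExtendScalars)

variable {R : Type} [CommRing R] (p : Submonoid R)

/-- Over a Noetherian ring, the vanishing of `Ext` out of a finitely generated module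
localizes. -/
theorem ExtVanishes.of_isLocalizedModule [IsNoetherianRing R] {B B' : Type} [AddCommGroup B]
    [Module R B] [AddCommGroup B'] [Module R B'] [Module (Localization p) B']
    [IsScalarTower R (Localization p) B'] (g : B →ₗ[R] B') [IsLocalizedModule p g] (i : ℕ) :
    ∀ {A A' : Type} [AddCommGroup A] [Module R A] [Module.Finite R A] [AddCommGroup A']
      [Module R A'] [Module (Localization p) A'] [IsScalarTower R (Localization p) A']
      (f : A →ₗ[R] A') [IsLocalizedModule p f],
      ExtVanishes R A B (i + 1) → ExtVanishes (Localization p) A' B' (i + 1) := by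
  induction i with
  | zero =>
    intro A A' _ _ _ _ _ _ _ f _ hV
    obtain ⟨n, π, hπ⟩ := Module.Finite.exists_fin' R A
    let ι : LinearMap.ker π →ₗ[R] (Fin n → R) := (LinearMap.ker π).subtype
    have hex : Function.Exact ι π := LinearMap.exact_subtype_ker_map π
    have hι : Function.Injective ι := (LinearMap.ker π).injective_subtype
    let z := LocalizedModule.mkLinearMap p (LinearMap.ker π)
    let e := LocalizedModule.mkLinearMap p (Fin n → R)
    have : Module.Projective (Localization p) (LocalizedModule p (Fin n → R)) :=
      Module.projective_of_isLocalizedModule p e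
    have : Module.FinitePresentation R (LinearMap.ker π) :=
      Module.finitePresentation_of_finite R _
    let ι' := mapExtendScalars p z e (Localization p) ι
    let π' := mapExtendScalars p e f (Localization p) π
    have hι' : Function.Injective ι' := IsLocalizedModule.map_injective p z e ι hι
    have hex' : Function.Exact ι' π' := IsLocalizedModule.map_exact p z e f ι π hex
    have hπ' : Function.Surjective π' := IsLocalizedModule.map_surjective p e f π hπ
    refine of_exists_extension (A := LocalizedModule p (LinearMap.ker π)) hι' hex' hπ' (of_projective 0) fun φ => ?_
    have := Module.FinitePresentation.isLocalizedModule_mapExtendScalars p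
      (M' := LocalizedModule p (LinearMap.ker π)) z g (Localization p)
    obtain ⟨⟨φ₀, s⟩, hs⟩ := IsLocalizedModule.surj p (mapExtendScalars p z g (Localization p)) φ
    obtain ⟨ψ, rfl⟩ := exists_extension hι hex hπ hV φ₀
    have hcomp : mapExtendScalars p z g (Localization p) (ψ ∘ₗ ι) =
        mapExtendScalars p e g (Localization p) ψ ∘ₗ mapExtendScalars p z e (Localization p) ι := by
      ext x
      exact LinearMap.congr_fun (IsLocalizedModule.map_comp' p z e g ι ψ) x
    refine ⟨IsLocalization.mk' (Localization p) 1 s • mapExtendScalars p e g (Localization p) ψ, ?_⟩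
    rw [LinearMap.smul_comp, ← hcomp, ← hs]
    dsimp only
    rw [Submonoid.smul_def, ← algebraMap_smul (Localization p) (s : R) φ, smul_smul,
      IsLocalization.mk'_spec, map_one, one_smul]
  | succ i ih =>
    intro A A' _ _ _ _ _ _ _ f _ hV
    obtain ⟨n, π, hπ⟩ := Module.Finite.exists_fin' R A
    let ι : LinearMap.ker π →ₗ[R] (Fin n → R) := (LinearMap.ker π).subtype
    have hex : Function.Exact ι π := LinearMap.exact_subtype_ker_map π
    have hι : Function.Injective ι := (LinearMap.ker π).injective_subtype
    let z := LocalizedModule.mkLinearMap p (LinearMap.ker π)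
    let e := LocalizedModule.mkLinearMap p (Fin n → R)
    have : Module.Projective (Localization p) (LocalizedModule p (Fin n → R)) :=
      Module.projective_of_isLocalizedModule p e
    let ι' := mapExtendScalars p z e (Localization p) ι
    let π' := mapExtendScalars p e f (Localization p) π
    have hι' : Function.Injective ι' := IsLocalizedModule.map_injective p z e ι hι
    have hex' : Function.Exact ι' π' := IsLocalizedModule.map_exact p z e f ι π hex
    have hπ' : Function.Surjective π' := IsLocalizedModule.map_surjective p e f π hπ
    exact right (A := LocalizedModule p (LinearMap.ker π)) hι' hex' hπ'
      (ih (A' := LocalizedModule p (LinearMap.ker π)) z (left hι hex hπ (of_projective i) hV))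
      (of_projective (i + 1))

theorem hasInjectiveDimensionLE_localizedModule [IsNoetherianRing R] (W : Type) [AddCommGroup W]
    [Module R W] (r : ℕ) (h : HasInjectiveDimensionLE (ModuleCat.of R W) r) :
    HasInjectiveDimensionLE (ModuleCat.of (Localization p) (LocalizedModule p W)) r := by
  have h1 := (ModuleCat.of R W).localizedModule_hasInjectiveDimensionLE r p
  have := (ModuleCat.of R W).localizedModule_isLocalizedModule p
  let e : (ModuleCat.of R W).localizedModule p ≃ₗ[R] LocalizedModule p W :=
    IsLocalizedModule.linearEquiv p ((ModuleCat.of R W).localizedModuleMkLinearMap p)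
      (LocalizedModule.mkLinearMap p W)
  exact hasInjectiveDimensionLT_of_iso
    (e.extendScalarsOfIsLocalization p (Localization p)).toModuleIso (r + 1)

end Localization

section LocalizationFactorIdeal

open IsLocalizedModule (mapExtendScalars)

variable {R : Type} [CommRing R] {N : Type} [AddCommGroup N] [Module R N]

theorem id_mem_range_dualTensorHom_of_projective [Module.Finite R N] [Module.Projective R N] :
    LinearMap.id ∈ LinearMap.range (dualTensorHom R N N) := by
  obtain ⟨n, π, hπ⟩ := Module.Finite.exists_fin' R N
  obtain ⟨σ, hσ⟩ := Module.projective_lifting_property π LinearMap.id hπ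
  refine ⟨∑ j, (LinearMap.proj j ∘ₗ σ) ⊗ₜ π (Pi.single j 1), LinearMap.ext fun x => ?_⟩
  have h1 := LinearMap.congr_fun hσ x
  rw [LinearMap.comp_apply, ← LinearMap.sum_single_apply (fun _ => R) (σ x)] at h1
  simpa [dualTensorHom_apply, ← map_smul, ← Pi.single_smul] using h1

variable (p : Submonoid R)

theorem mapExtendScalars_mem_range_dualTensorHom {φ : N →ₗ[R] N}
    (hφ : φ ∈ LinearMap.range (dualTensorHom R N N)) :
    mapExtendScalars p (LocalizedModule.mkLinearMap p N) (LocalizedModule.mkLinearMap p N)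
      (Localization p) φ ∈ LinearMap.range
        (dualTensorHom (Localization p) (LocalizedModule p N) (LocalizedModule p N)) := by
  obtain ⟨t, rfl⟩ := hφ
  induction t with
  | zero => simp
  | add a b ha hb => rw [map_add, map_add]; exact add_mem ha hb
  | tmul α x =>
    refine ⟨mapExtendScalars p (LocalizedModule.mkLinearMap p N)
      (Algebra.linearMap R (Localization p)) (Localization p) α ⊗ₜ
        LocalizedModule.mkLinearMap p N x, ?_⟩
    refine LinearMap.restrictScalars_injective R (IsLocalizedModule.linearMap_ext p
      (LocalizedModule.mkLinearMap p N) (LocalizedModule.mkLinearMap p N) ?_)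
    ext y
    simp [dualTensorHom_apply, -LocalizedModule.mkLinearMap_apply, IsLocalizedModule.map_apply]

theorem map_freeFactorIdeal_le : (freeFactorIdeal R N).map (algebraMap R (Localization p)) ≤
    freeFactorIdeal (Localization p) (LocalizedModule p N) := by
  refine Ideal.map_le_iff_le_comap.2 fun s hs => ?_
  have h1 := mapExtendScalars_mem_range_dualTensorHom p (mem_freeFactorIdeal.1 hs)
  have h2 : mapExtendScalars p (LocalizedModule.mkLinearMap p N) (LocalizedModule.mkLinearMap p N)
      (Localization p) LinearMap.id = LinearMap.id := by
    ext x
    simp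
  rwa [map_smul, h2, ← algebraMap_smul (Localization p) s] at h1

theorem exists_smul_eq_mapExtendScalars [Module.FinitePresentation R N]
    {ψ : LocalizedModule p N →ₗ[Localization p] LocalizedModule p N}
    (hψ : ψ ∈ LinearMap.range
        (dualTensorHom (Localization p) (LocalizedModule p N) (LocalizedModule p N))) :
    ∃ s ∈ p, ∃ φ ∈ LinearMap.range (dualTensorHom R N N), s • ψ = mapExtendScalars p
      (LocalizedModule.mkLinearMap p N) (LocalizedModule.mkLinearMap p N) (Localization p) φ := by
  obtain ⟨t, rfl⟩ := hψ
  induction t with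
  | zero => exact ⟨1, one_mem _, 0, zero_mem _, by simp⟩
  | add a b ha hb =>
    obtain ⟨s, hs, φ, hφ, h1⟩ := ha
    obtain ⟨t, ht, ψ, hψ, h2⟩ := hb
    refine ⟨s * t, mul_mem hs ht, t • φ + s • ψ,
      add_mem (Submodule.smul_mem _ _ hφ) (Submodule.smul_mem _ _ hψ), ?_⟩
    rw [map_add, map_add, map_smul, map_smul, ← h1, ← h2, smul_add, mul_smul, mul_smul,
      smul_comm s t]
  | tmul α x =>
    obtain ⟨⟨α₀, s⟩, hs⟩ := IsLocalizedModule.surj p (mapExtendScalars p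
      (LocalizedModule.mkLinearMap p N) (Algebra.linearMap R (Localization p)) (Localization p)) α
    obtain ⟨⟨x₀, t⟩, ht⟩ := IsLocalizedModule.surj p (LocalizedModule.mkLinearMap p N) x
    refine ⟨s * t, mul_mem s.2 t.2, _, ⟨α₀ ⊗ₜ x₀, rfl⟩, ?_⟩
    refine LinearMap.restrictScalars_injective R (IsLocalizedModule.linearMap_ext p
      (LocalizedModule.mkLinearMap p N) (LocalizedModule.mkLinearMap p N) ?_)
    ext y
    have h1 := LinearMap.congr_fun hs (LocalizedModule.mkLinearMap p N y)
    have h2 : (s : R) • α (LocalizedModule.mkLinearMap p N y) =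
        algebraMap R (Localization p) (α₀ y) := by
      simpa [-LocalizedModule.mkLinearMap_apply, IsLocalizedModule.map_apply,
        Submonoid.smul_def] using h1
    have h3 : (t : R) • x = LocalizedModule.mkLinearMap p N x₀ := ht
    simp only [LinearMap.comp_apply, LinearMap.restrictScalars_apply, LinearMap.smul_apply,
      dualTensorHom_apply, IsLocalizedModule.mapExtendScalars_apply_apply,
      IsLocalizedModule.map_apply, map_smul]
    rw [← h3, mul_smul, smul_comm (t : R), ← smul_assoc, h2, algebraMap_smul]

theorem exists_mem_freeFactorIdeal [Module.FinitePresentation R N]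
    [Module.Projective (Localization p) (LocalizedModule p N)] :
    ∃ s ∈ p, s ∈ freeFactorIdeal R N := by
  obtain ⟨s, hs, φ, hφ, h1⟩ := exists_smul_eq_mapExtendScalars p (N := N)
    id_mem_range_dualTensorHom_of_projective
  have h2 : mapExtendScalars p (LocalizedModule.mkLinearMap p N) (LocalizedModule.mkLinearMap p N)
      (Localization p) (s • LinearMap.id) = s • LinearMap.id := by
    ext x
    simp
  rw [← h2] at h1
  obtain ⟨c, hc⟩ := IsLocalizedModule.exists_of_eq (S := p) h1
  refine ⟨c * s, mul_mem c.2 hs, mem_freeFactorIdeal.2 ?_⟩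
  rw [mul_smul]
  exact hc ▸ Submodule.smul_mem _ (c : R) hφ

end LocalizationFactorIdeal

/-- A non-projective module has a non-projective localization for which some power of the
maximal ideal consists of scalars acting through a finite free module. -/
theorem exists_prime_of_not_projective {R : Type} [CommRing R] [IsNoetherianRing R] {N : Type}
    [AddCommGroup N] [Module R N] [Module.Finite R N] (hN : ¬ Module.Projective R N) :
    ∃ q : PrimeSpectrum R,
      ¬ Module.Projective (Localization.AtPrime q.asIdeal)
        (LocalizedModule q.asIdeal.primeCompl N) ∧
      ∃ k, maximalIdeal (Localization.AtPrime q.asIdeal) ^ k ≤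
        freeFactorIdeal (Localization.AtPrime q.asIdeal)
          (LocalizedModule q.asIdeal.primeCompl N) := by
  have hI : freeFactorIdeal R N ≠ ⊤ := fun hI => hN <| by
    have h1 : (1 : R) ∈ freeFactorIdeal R N := hI ▸ Submodule.mem_top
    rw [mem_freeFactorIdeal, one_smul] at h1
    exact projective_of_id_mem_range_dualTensorHom h1
  obtain ⟨q, hq⟩ := Ideal.nonempty_minimalPrimes hI
  have hqp : q.IsPrime := hq.1.1
  have : Module.FinitePresentation R N := Module.finitePresentation_of_finite R N
  refine ⟨⟨q, hqp⟩, fun hproj => ?_, ?_⟩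
  · obtain ⟨s, hs, hsI⟩ := exists_mem_freeFactorIdeal q.primeCompl (N := N)
    exact hs (hq.1.2 hsI)
  · have h1 := IsLocalization.AtPrime.radical_map_of_mem_minimalPrimes
      (A := Localization.AtPrime q) q (freeFactorIdeal R N) hq
    rw [IsLocalization.AtPrime.map_eq_maximalIdeal q (Localization.AtPrime q)] at h1
    obtain ⟨k, hk⟩ := Ideal.exists_radical_pow_le_of_fg
      ((freeFactorIdeal R N).map (algebraMap R (Localization.AtPrime q)))
      (IsNoetherian.noetherian _)
    rw [h1] at hk
    exact ⟨k, hk.trans (map_freeFactorIdeal_le q.primeCompl)⟩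

theorem IsMCM.moduleDepth_eq {R : Type} [CommRing R] {N : Type} [AddCommGroup N] [Module R N]
    (hN : IsMCM R N) (q : PrimeSpectrum R) [Nontrivial (LocalizedModule q.asIdeal.primeCompl N)]
    {h : ℕ} (hh : ringKrullDim (Localization.AtPrime q.asIdeal) = h) :
    moduleDepth (Localization.AtPrime q.asIdeal) (LocalizedModule q.asIdeal.primeCompl N) = h := by
  have h1 := hN q inferInstance
  rw [hh] at h1
  exact_mod_cast h1

namespace IsCanonicalModule

variable {R : Type} [CommRing R] [IsLocalRing R] {ω : Type} [AddCommGroup ω] [Module R ω]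

theorem nontrivial (hω : IsCanonicalModule R ω) : Nontrivial ω := by
  obtain ⟨-, -, -, d, -, ⟨e⟩⟩ := hω
  by_contra hs
  rw [not_nontrivial_iff_subsingleton] at hs
  have h1 : Limits.IsZero (ModuleCat.of R ω) := ModuleCat.isZero_of_subsingleton _
  have h2 := (hasInjectiveDimensionLT_zero_iff_isZero _).2 h1
  have h3 : ExtVanishes R (R ⧸ maximalIdeal R) ω d :=
    HasInjectiveDimensionLT.subsingleton (ModuleCat.of R ω) 0 d (Nat.zero_le d) _
  have h4 := (extVanishes_iff d).1 h3
  exact not_subsingleton (R ⧸ maximalIdeal R) (e.toEquiv.subsingleton_congr.1 h4)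

variable [IsNoetherianRing R]

theorem hasCanonicalExt (hω : IsCanonicalModule R ω) (q : PrimeSpectrum R)
    [Nontrivial (LocalizedModule q.asIdeal.primeCompl ω)]
    {h : ℕ} (hh : ringKrullDim (Localization.AtPrime q.asIdeal) = h) :
    HasCanonicalExt (Localization.AtPrime q.asIdeal)
      (LocalizedModule q.asIdeal.primeCompl ω) h := by
  obtain ⟨_, hmcm, ⟨r, hr⟩, -⟩ := hω
  exact hasCanonicalExt_of_moduleDepth_eq hh (hmcm.moduleDepth_eq q hh)
    (hasInjectiveDimensionLE_localizedModule q.asIdeal.primeCompl ω r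
      (hasInjectiveDimensionLE_of_hasInjDimLE r ω hr))

theorem annihilator_eq_bot (hω : IsCanonicalModule R ω) {d : ℕ} (hd : ringKrullDim R = (d + 1 : ℕ)) :
    Module.annihilator R ω = ⊥ := by
  have := hω.nontrivial
  let q := closedPoint R
  let f := LocalizedModule.mkLinearMap q.asIdeal.primeCompl ω
  have hunit (s : q.asIdeal.primeCompl) : IsUnit (s : R) :=
    notMem_maximalIdeal.1 s.2
  have hinj : Function.Injective f := by
    refine (injective_iff_map_eq_zero f).2 fun x hx => ?_
    obtain ⟨c, hc⟩ := (IsLocalizedModule.eq_zero_iff q.asIdeal.primeCompl f).1 hx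
    exact (hunit c).smul_eq_zero.1 hc
  have : Nontrivial (LocalizedModule q.asIdeal.primeCompl ω) := hinj.nontrivial
  have hh : ringKrullDim (Localization.AtPrime q.asIdeal) = (d + 1 : ℕ) := by
    rw [IsLocalization.AtPrime.ringKrullDim_eq_height q.asIdeal, ← hd]
    exact maximalIdeal_height_eq_ringKrullDim
  have h0 := (hω.hasCanonicalExt q hh).annihilator_eq_bot
  refine (Submodule.eq_bot_iff _).2 fun a ha => ?_
  have h1 : algebraMap R (Localization.AtPrime q.asIdeal) a ∈
      Module.annihilator (Localization.AtPrime q.asIdeal)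
        (LocalizedModule q.asIdeal.primeCompl ω) := by
    refine Module.mem_annihilator.2 fun x => ?_
    obtain ⟨⟨x, s⟩, rfl⟩ := IsLocalizedModule.mk'_surjective q.asIdeal.primeCompl f x
    rw [algebraMap_smul, Function.uncurry_apply_pair, ← IsLocalizedModule.mk'_smul,
      Module.mem_annihilator.1 ha, IsLocalizedModule.mk'_zero]
  rw [h0, Ideal.mem_bot, IsLocalization.map_eq_zero_iff q.asIdeal.primeCompl] at h1
  obtain ⟨c, hc⟩ := h1
  exact (hunit c).mul_right_eq_zero.1 hc

theorem nontrivial_localizedModule (hω : IsCanonicalModule R ω) {d : ℕ}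
    (hd : ringKrullDim R = (d + 1 : ℕ)) (q : PrimeSpectrum R) :
    Nontrivial (LocalizedModule q.asIdeal.primeCompl ω) := by
  have := hω.1
  exact Module.mem_support_iff_of_finite.2 (hω.annihilator_eq_bot hd ▸ bot_le)

end IsCanonicalModule

/-- A maximal Cohen–Macaulay module `M`, locally of finite projective dimension in
codimension `n`, with `Ext^i(M^*, M^†) = 0` for `n ≤ i ≤ d−1`, is free. -/
theorem free_of_ext_dual_vanishing (R : Type) [CommRing R] [IsNoetherianRing R]
    [IsLocalRing R] (d n : ℕ) (hd : ringKrullDim R = d) (hd2 : 2 ≤ d)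
    (hn1 : 1 ≤ n) (hn2 : n ≤ d - 1) (hCM : IsCMLocal R)
    (ω : Type) [AddCommGroup ω] [Module R ω] (hω : IsCanonicalModule R ω)
    (M : Type) [AddCommGroup M] [Module R M] [Module.Finite R M]
    (hM : IsMCM R M)
    (hMp : ∀ p : PrimeSpectrum R, ringKrullDim (Localization.AtPrime p.asIdeal) ≤ (n : WithBot ℕ∞) →
      ∃ k : ℕ, hasPdLE (Localization.AtPrime p.asIdeal) k (LocalizedModule p.asIdeal.primeCompl M))
    (h : ∀ i : ℕ, n ≤ i → i ≤ d - 1 →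
      Subsingleton (extGroup R i (M →ₗ[R] R) (M →ₗ[R] ω))) :
    Module.Free R M := by
  suffices hP : Module.Projective R M from Module.free_of_flat_of_isLocalRing
  by_contra hM0
  obtain ⟨q, hq, k, hk⟩ := exists_prime_of_not_projective hM0
  set S := Localization.AtPrime q.asIdeal
  set N := LocalizedModule q.asIdeal.primeCompl M
  set W := LocalizedModule q.asIdeal.primeCompl ω
  have hωfin : Module.Finite R ω := hω.1
  have hdpos : ringKrullDim R = ((d - 1) + 1 : ℕ) := by rw [hd, Nat.sub_add_cancel (by omega)]
  have : Nontrivial W := hω.nontrivial_localizedModule hdpos q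
  have : Nontrivial N := by
    by_contra hs
    rw [not_nontrivial_iff_subsingleton] at hs
    exact hq (inferInstanceAs (Module.Projective S N))
  obtain ⟨t, ht, htd⟩ : ∃ t : ℕ, ringKrullDim S = t ∧ t ≤ d := by
    have h1 : ringKrullDim S = q.asIdeal.height :=
      IsLocalization.AtPrime.ringKrullDim_eq_height q.asIdeal S
    have h2 : (q.asIdeal.height : WithBot ℕ∞) ≤ d :=
      hd ▸ Ideal.height_le_ringKrullDim_of_ne_top q.2.ne_top
    have h3 : q.asIdeal.height ≤ d := by exact_mod_cast h2
    obtain ⟨t, ht⟩ := ENat.ne_top_iff_exists.1 (ne_top_of_le_ne_top (ENat.natCast_ne_top d) h3)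
    rw [← ht] at h1 h3
    exact ⟨t, h1, by exact_mod_cast h3⟩
  have hcan : HasCanonicalExt S W t := hω.hasCanonicalExt q ht
  obtain ⟨rs, hrs, hmem, hreg⟩ := exists_isRegular_of_moduleDepth_eq (hM.moduleDepth_eq q ht)
  rcases le_or_gt t n with htn | htn
  · obtain ⟨l, hl⟩ := hMp q (ht ▸ by exact_mod_cast htn)
    exact hq <| projective_of_hasProjectiveDimensionLE (W := W) l N
      (hasProjectiveDimensionLE_of_hasPdLE l N hl) fun i =>
        ExtVanishes.of_isWeaklyRegular hcan.high rs N hmem hreg.toIsWeaklyRegular (by omega)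
  · obtain ⟨u, rfl⟩ : ∃ u, t = u + 2 := ⟨t - 2, by omega⟩
    have hV : ExtVanishes R (M →ₗ[R] R) (M →ₗ[R] ω) (u + 1) :=
      (extVanishes_iff (u + 1)).2 (h (u + 1) (by omega) (by omega))
    have : Module.FinitePresentation R M := Module.finitePresentation_of_finite R M
    let m := LocalizedModule.mkLinearMap q.asIdeal.primeCompl M
    exact hq <| hcan.projective hk hrs hmem hreg.toIsWeaklyRegular <|
      ExtVanishes.of_isLocalizedModule q.asIdeal.primeCompl
        (IsLocalizedModule.mapExtendScalars q.asIdeal.primeCompl m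
          (LocalizedModule.mkLinearMap q.asIdeal.primeCompl ω) S) u
        (IsLocalizedModule.mapExtendScalars q.asIdeal.primeCompl m (Algebra.linearMap R S) S) hV
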